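/- arXiv:2307.14364 — 2 statements merged into one kernel-verified Lean document; each statement's English description precedes it below -/
import Mathlib

section
/- Reciprocal-square sum lower bound (Eq. A92): for all real numbers A > 0 and B ≥ 0 and for all natural numbers a ≤ b, Σ_{t=a}^{b} 1/(A·(t+1)^{1/3} + B)² ≥ (b^{1/3} − a^{1/3}) / (A + B)², where the powers denote real cube roots and real exponentiation of nonnegative reals. -/
open scoped BigOperators

lemma add_one_rpow_third_sub_le {x : ℝ} (hx : 0 ≤ x) :
    (x + 1) ^ ((1 : ℝ) / 3) - x ^ ((1 : ℝ) / 3) ≤ 1 / ((x + 1) ^ ((1 : ℝ) / 3)) ^ 2 := by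
  have cube {z : ℝ} (hz : 0 ≤ z) : (z ^ ((1 : ℝ) / 3)) ^ 3 = z := by
    rw [← Real.rpow_natCast, ← Real.rpow_mul hz]
    norm_num
  have hu : 0 ≤ x ^ ((1 : ℝ) / 3) := by positivity
  have hv : 0 < (x + 1) ^ ((1 : ℝ) / 3) := by positivity
  have huv : x ^ ((1 : ℝ) / 3) ≤ (x + 1) ^ ((1 : ℝ) / 3) := by
    gcongr
    linarith
  have hu3 := cube hx
  have hv3 := cube (z := x + 1) (by linarith)
  generalize x ^ ((1 : ℝ) / 3) = u at *
  generalize (x + 1) ^ ((1 : ℝ) / 3) = v at *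
  rw [le_div_iff₀ (by positivity)]
  have : 0 ≤ (v - u) * (u * v + u ^ 2) := mul_nonneg (by linarith) (by positivity)
  linarith [show (v - u) * v ^ 2 + (v - u) * (u * v + u ^ 2) = v ^ 3 - u ^ 3 by ring]

lemma add_one_rpow_third_sub_div_le {A B x : ℝ} (hA : 0 < A) (hB : 0 ≤ B) (hx : 0 ≤ x) :
    ((x + 1) ^ ((1 : ℝ) / 3) - x ^ ((1 : ℝ) / 3)) / (A + B) ^ 2 ≤
      1 / (A * (x + 1) ^ ((1 : ℝ) / 3) + B) ^ 2 := by
  have hv : 1 ≤ (x + 1) ^ ((1 : ℝ) / 3) := Real.one_le_rpow (by linarith) (by norm_num)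
  calc ((x + 1) ^ ((1 : ℝ) / 3) - x ^ ((1 : ℝ) / 3)) / (A + B) ^ 2
      ≤ 1 / ((x + 1) ^ ((1 : ℝ) / 3)) ^ 2 / (A + B) ^ 2 := by
        gcongr
        exact add_one_rpow_third_sub_le hx
    _ = 1 / ((A + B) * (x + 1) ^ ((1 : ℝ) / 3)) ^ 2 := by
        rw [div_div, mul_pow, mul_comm]
    _ ≤ 1 / (A * (x + 1) ^ ((1 : ℝ) / 3) + B) ^ 2 := by
        gcongr
        nlinarith [mul_nonneg hB (sub_nonneg.2 hv)]

/-- Reciprocal-square sum lower bound (Eq. A92). -/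
theorem sum_reciprocal_sq_lower_bound (A B : ℝ) (hA : 0 < A) (hB : 0 ≤ B)
    (a b : ℕ) (hab : a ≤ b) :
    ((b : ℝ) ^ ((1 : ℝ) / 3) - (a : ℝ) ^ ((1 : ℝ) / 3)) / (A + B) ^ 2 ≤
      ∑ t ∈ Finset.Icc a b, 1 / (A * ((t : ℝ) + 1) ^ ((1 : ℝ) / 3) + B) ^ 2 := by
  have telescope : ∑ t ∈ Finset.Ico a b,
      (((t : ℝ) + 1) ^ ((1 : ℝ) / 3) - (t : ℝ) ^ ((1 : ℝ) / 3)) =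
        (b : ℝ) ^ ((1 : ℝ) / 3) - (a : ℝ) ^ ((1 : ℝ) / 3) := by
    exact_mod_cast Finset.sum_Ico_sub (fun t : ℕ => (t : ℝ) ^ ((1 : ℝ) / 3)) hab
  rw [← telescope, Finset.sum_div]
  calc _ ≤ ∑ t ∈ Finset.Ico a b, 1 / (A * ((t : ℝ) + 1) ^ ((1 : ℝ) / 3) + B) ^ 2 :=
        Finset.sum_le_sum fun t _ => add_one_rpow_third_sub_div_le hA hB t.cast_nonneg
    _ ≤ _ := Finset.sum_le_sum_of_subset_of_nonneg Finset.Ico_subset_Icc_self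
        fun t _ _ => by positivity
end

section
/- Asynchronous staleness telescoping bound (Eq. A87-1, single-worker form). Let H be a real inner product space, let σ ≥ 0, and let τ ≥ 1 be an integer. Let φ : ℕ → H satisfy ‖φ(t)‖ ≤ σ for all t ∈ ℕ. Let V ⊆ ℕ be a set of activation times such that (i) for every t ∈ ℕ there exists v ∈ V with t < v ≤ t + τ, and (ii) φ(t+1) = φ(t) whenever t + 1 ∉ V. For t ∈ ℕ let n(t) = min{v ∈ V : v > t} denote the next activation time after t. Then for all natural numbers a ≤ b: Σ_{t=a}^{b} ‖φ(n(t)) − φ(t)‖² ≤ τ·Σ_{t=a}^{b} ‖φ(t+1) − φ(t)‖² + 4τ(τ−1)σ². -/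
open scoped BigOperators

/-- Shifting the summand by `j` costs at most `j` boundary terms. -/
theorem sum_Icc_add_le (d : ℕ → ℝ) (C : ℝ) (hd0 : ∀ s, 0 ≤ d s) (hdC : ∀ s, d s ≤ C)
    (a b : ℕ) (hab : a ≤ b) (j : ℕ) :
    ∑ t ∈ Finset.Icc a b, d (t + j) ≤ ∑ t ∈ Finset.Icc a b, d t + j * C := by
  induction j with
  | zero => simp
  | succ j ih =>
    have shift : ∑ t ∈ Finset.Icc a b, d (t + (j + 1)) + d (a + j)
        = ∑ t ∈ Finset.Icc a b, d (t + j) + d (b + (j + 1)) := by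
      clear ih
      induction b, hab using Nat.le_induction with
      | base => simp [add_comm]
      | succ b hb ih =>
        rw [Finset.sum_Icc_succ_top (by omega), Finset.sum_Icc_succ_top (by omega)]
        have h : b + 1 + j = b + (j + 1) := by omega
        rw [h]
        linarith
    have h0 := hd0 (a + j)
    have hC := hdC (b + (j + 1))
    push_cast
    linarith

/-- Asynchronous staleness telescoping bound (Eq. A87-1, single-worker form). -/
theorem staleness_telescoping
    {H : Type*} [NormedAddCommGroup H] [InnerProductSpace ℝ H]
    (σ : ℝ) (hσ : 0 ≤ σ) (τ : ℕ) (hτ : 1 ≤ τ)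
    (φ : ℕ → H) (hφ : ∀ t, ‖φ t‖ ≤ σ)
    (V : Set ℕ)
    (hV1 : ∀ t : ℕ, ∃ v ∈ V, t < v ∧ v ≤ t + τ)
    (hV2 : ∀ t : ℕ, t + 1 ∉ V → φ (t + 1) = φ t)
    (n : ℕ → ℕ)
    (hn : ∀ t, n t ∈ V ∧ t < n t ∧ ∀ v ∈ V, t < v → n t ≤ v)
    (a b : ℕ) (hab : a ≤ b) :
    ∑ t ∈ Finset.Icc a b, ‖φ (n t) - φ t‖ ^ 2 ≤
      (τ : ℝ) * (∑ t ∈ Finset.Icc a b, ‖φ (t + 1) - φ t‖ ^ 2)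
        + 4 * (τ : ℝ) * ((τ : ℝ) - 1) * σ ^ 2 := by
  set d : ℕ → ℝ := fun s => ‖φ (s + 1) - φ s‖ ^ 2 with hd
  have hd0 : ∀ s, 0 ≤ d s := fun s => sq_nonneg _
  have hdC : ∀ s, d s ≤ 4 * σ ^ 2 := fun s => by
    have h : ‖φ (s + 1) - φ s‖ ≤ 2 * σ := by
      linarith [norm_sub_le (φ (s + 1)) (φ s), hφ (s + 1), hφ s]
    calc d s ≤ (2 * σ) ^ 2 := pow_le_pow_left₀ (norm_nonneg _) h 2
      _ = 4 * σ ^ 2 := by ring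
  have const : ∀ t k, t + k < n t → φ (t + k) = φ t := by
    intro t k
    induction k with
    | zero => simp
    | succ k ih =>
      intro hk
      rw [← ih (by omega)]
      refine hV2 (t + k) fun hmem => ?_
      have := (hn t).2.2 _ hmem (by omega)
      omega
  have point : ∀ t, ‖φ (n t) - φ t‖ ^ 2 ≤ ∑ j ∈ Finset.range τ, d (t + j) := by
    intro t
    obtain ⟨v, hv, htv, hvτ⟩ := hV1 t
    obtain ⟨-, hlt, hmin⟩ := hn t
    have hnv := hmin v hv htv
    obtain ⟨k, hk⟩ := Nat.exists_eq_add_of_lt hlt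
    have h : ‖φ (n t) - φ t‖ ^ 2 = d (t + k) := by
      rw [hd, ← const t k (by omega), hk]
    rw [h]
    exact Finset.single_le_sum (f := fun j => d (t + j)) (fun j _ => hd0 _)
      (Finset.mem_range.2 (by omega))
  calc ∑ t ∈ Finset.Icc a b, ‖φ (n t) - φ t‖ ^ 2
      ≤ ∑ t ∈ Finset.Icc a b, ∑ j ∈ Finset.range τ, d (t + j) :=
        Finset.sum_le_sum fun t _ => point t
    _ = ∑ j ∈ Finset.range τ, ∑ t ∈ Finset.Icc a b, d (t + j) := Finset.sum_comm
    _ ≤ ∑ _j ∈ Finset.range τ,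
          (∑ t ∈ Finset.Icc a b, d t + ((τ : ℝ) - 1) * (4 * σ ^ 2)) := by
        refine Finset.sum_le_sum fun j hj => ?_
        refine (sum_Icc_add_le d _ hd0 hdC a b hab j).trans ?_
        have hj' : (j : ℝ) + 1 ≤ τ := by exact_mod_cast Finset.mem_range.1 hj
        gcongr
        linarith
    _ = _ := by
        rw [Finset.sum_const, Finset.card_range, nsmul_eq_mul]
        ring
end
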